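/- (Schur–Horn) Let n ≥ 1, and let λ = (λ₁, …, λₙ) and d = (d₁, …, dₙ) be vectors of real numbers. There exists an n×n complex Hermitian matrix A whose diagonal entries are A_{jj} = dⱼ and whose multiset of eigenvalues (with multiplicity) equals the multiset {λ₁, …, λₙ} if and only if d lies in the convex hull in ℝⁿ of the set of all vectors (λ_{σ(1)}, …, λ_{σ(n)}) obtained by permuting the entries of λ. -/

import Mathlib

namespace SchurHornAux

open Matrix

/-- achievable diagonals -/
def Ach {n : ℕ} (lam x : Fin n → ℝ) : Prop :=
  ∃ A : Matrix (Fin n) (Fin n) ℂ, A.IsHermitian ∧ (∀ j, A j j = (x j : ℂ)) ∧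
    A.charpoly = ∏ i, (Polynomial.X - Polynomial.C (lam i : ℂ))

lemma charpoly_conj {n : ℕ} (U A V : Matrix (Fin n) (Fin n) ℂ) (h : V * U = 1) :
    (U * A * V).charpoly = A.charpoly := by
  rw [Matrix.charpoly_mul_comm, ← mul_assoc, h, one_mul]

lemma ach_perm {n : ℕ} {lam x : Fin n → ℝ} (h : Ach lam x) (σ : Equiv.Perm (Fin n)) :
    Ach lam (x ∘ σ) := by
  obtain ⟨A, hA, hd, hc⟩ := h
  refine ⟨A.submatrix σ σ, hA.submatrix σ, fun j => by simp [hd], ?_⟩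
  rw [← hc, ← Matrix.charpoly_reindex σ.symm A]
  simp [Matrix.reindex_apply]

lemma ach_self {n : ℕ} (lam : Fin n → ℝ) : Ach lam lam := by
  refine ⟨Matrix.diagonal (fun i => (lam i : ℂ)), ?_, by simp, Matrix.charpoly_diagonal _⟩
  rw [Matrix.IsHermitian, Matrix.diagonal_conjTranspose]
  congr 1
  ext i
  simp

lemma ach_phase {n : ℕ} {lam x : Fin n → ℝ} (h : Ach lam x) (j k : Fin n) (hjk : j ≠ k) :
    ∃ A : Matrix (Fin n) (Fin n) ℂ, A.IsHermitian ∧ (∀ j, A j j = (x j : ℂ)) ∧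
    A.charpoly = ∏ i, (Polynomial.X - Polynomial.C (lam i : ℂ)) ∧ A j k = A k j := by
  obtain ⟨A, hA, hd, hc⟩ := h
  obtain ⟨w, hw, r, hr⟩ : ∃ w : ℂ, w * star w = 1 ∧ ∃ r : ℝ, w * A j k = r := by
    by_cases h0 : A j k = 0
    · exact ⟨1, by simp, 0, by simp [h0]⟩
    · have hn : (‖A j k‖ : ℂ) ≠ 0 := by simpa using h0
      have h1 : star (A j k) * A j k = (‖A j k‖ : ℂ) ^ 2 := Complex.conj_mul' _
      refine ⟨star (A j k) / ‖A j k‖, ?_, ‖A j k‖, ?_⟩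
      · have : star (star (A j k) / (‖A j k‖ : ℂ)) = A j k / ‖A j k‖ := by
          simp
        rw [this, div_mul_div_comm, h1]
        field_simp
      · rw [div_mul_eq_mul_div, h1]
        field_simp
  have hw' : star w * w = 1 := by rw [mul_comm]; exact hw
  let D : Matrix (Fin n) (Fin n) ℂ := Matrix.diagonal (fun i => if i = j then w else 1)
  have hDH : Dᴴ = Matrix.diagonal (fun i => if i = j then star w else 1) := by
    simp only [D, Matrix.diagonal_conjTranspose]
    congr 1
    ext i
    by_cases hi : i = j <;> simp [hi]
  have hherm : (D * A * Dᴴ).IsHermitian := Matrix.isHermitian_mul_mul_conjTranspose D hA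
  have hval : ∀ a b, (D * A * Dᴴ) a b =
      (if a = j then w else 1) * A a b * (if b = j then star w else 1) := by
    intro a b
    rw [hDH, Matrix.mul_diagonal, Matrix.diagonal_mul]
  refine ⟨D * A * Dᴴ, hherm, ?_, ?_, ?_⟩
  · intro i
    rw [hval, ← hd i]
    by_cases hi : i = j
    · simp only [hi, if_true]
      linear_combination A j j * hw
    · simp [hi]
  · rw [charpoly_conj, hc]
    rw [hDH, Matrix.diagonal_mul_diagonal, ← Matrix.diagonal_one]
    congr 1
    ext i
    by_cases hi : i = j
    · simp only [hi, if_true]; exact hw'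
    · simp [hi]
  · have h1 : (D * A * Dᴴ) j k = r := by
      rw [hval, ← hr]; simp [hjk.symm]
    rw [h1, ← hherm.apply k j, h1]
    simp

lemma ach_T {n : ℕ} {lam x : Fin n → ℝ} (h : Ach lam x) (j k : Fin n) (hjk : j ≠ k)
    (t : ℝ) (ht0 : 0 ≤ t) (ht1 : t ≤ 1) :
    Ach lam (fun i => (1 - t) * x i + t * x (Equiv.swap j k i)) := by
  obtain ⟨A, hA, hd, hc, hs⟩ := ach_phase h j k hjk
  let σ := Equiv.swap j k
  let c : ℂ := (Real.sqrt (1 - t) : ℂ)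
  let s : ℂ := (Real.sqrt t : ℂ)
  have hcc : c * c = 1 - t := by
    simp only [c]; rw [← Complex.ofReal_mul, Real.mul_self_sqrt (by linarith)]; simp
  have hss : s * s = t := by
    simp only [s]; rw [← Complex.ofReal_mul, Real.mul_self_sqrt ht0]
  let P : Matrix (Fin n) (Fin n) ℂ := (1 : Matrix (Fin n) (Fin n) ℂ).submatrix σ id
  have hPl : ∀ B : Matrix (Fin n) (Fin n) ℂ, P * B = B.submatrix σ id := by
    intro B
    ext a b
    simp [P, Matrix.mul_apply, Matrix.one_apply]
  have hPr : ∀ B : Matrix (Fin n) (Fin n) ℂ, B * P = B.submatrix id σ := by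
    intro B
    ext a b
    simp only [P, Matrix.mul_apply, Matrix.submatrix_apply, Matrix.one_apply, id]
    rw [Finset.sum_eq_single (σ b)]
    · simp [σ]
    · intro c _ hc
      rw [if_neg, mul_zero]
      rintro rfl
      exact hc (by simp [σ])
    · simp
  have hPP : P * P = 1 := by
    rw [hPl]
    ext a b
    change (1 : Matrix (Fin n) (Fin n) ℂ) (σ (σ a)) b = _
    rw [show σ (σ a) = a by simp [σ]]
  have hPH : Pᴴ = P := by
    ext a b
    simp only [P, Matrix.conjTranspose_apply, Matrix.submatrix_apply, Matrix.one_apply, id]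
    have : σ b = a ↔ σ a = b := by
      constructor <;> (rintro rfl; simp [σ])
    by_cases hab : σ a = b <;> simp [this, hab]
  let U : Matrix (Fin n) (Fin n) ℂ := c • 1 + (Complex.I * s) • P
  have hUH : Uᴴ = c • 1 - (Complex.I * s) • P := by
    simp only [U, Matrix.conjTranspose_add, Matrix.conjTranspose_smul, hPH,
      Matrix.conjTranspose_one]
    have h1 : star c = c := Complex.conj_ofReal _
    have h2 : star (Complex.I * s) = - (Complex.I * s) := by
      have : star s = s := Complex.conj_ofReal _
      rw [star_mul, this]
      simp [mul_comm]
    rw [h1, h2, neg_smul, sub_eq_add_neg]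
  have hUU : Uᴴ * U = 1 := by
    rw [hUH]
    simp only [U, sub_mul, mul_add, smul_mul_assoc, mul_smul_comm, one_mul, mul_one, hPP,
      smul_smul]
    have h3 : (Complex.I * s) * (Complex.I * s) = -(t:ℂ) := by
      linear_combination (Complex.I * Complex.I) * hss + t * Complex.I_mul_I
    have h5 : c * c - (Complex.I * s) * (Complex.I * s) = 1 := by rw [hcc, h3]; ring
    calc _ = (c * c - (Complex.I * s) * (Complex.I * s)) • (1 : Matrix (Fin n) (Fin n) ℂ) := by
            module
      _ = 1 := by rw [h5, one_smul]
  refine ⟨U * A * Uᴴ, Matrix.isHermitian_mul_mul_conjTranspose U hA, ?_, ?_⟩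
  · intro i
    rw [hUH]
    simp only [U, mul_sub, add_mul, smul_mul_assoc, mul_smul_comm, one_mul, mul_one, smul_smul,
      hPl, hPr, Matrix.sub_apply, Matrix.add_apply, Matrix.smul_apply, Matrix.submatrix_apply,
      id, smul_eq_mul, hd]
    have h4 : A i (σ i) = A (σ i) i := by
      by_cases h1 : i = j
      · subst h1; simpa [σ] using hs
      · by_cases h2 : i = k
        · subst h2; simpa [σ] using hs.symm
        · simp [σ, Equiv.swap_apply_of_ne_of_ne h1 h2]
    rw [h4]
    push_cast
    change _ = (1 - (t:ℂ)) * x i + t * x (σ i)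
    linear_combination (x i : ℂ) * hcc + (x (σ i) : ℂ) * hss
      - s * s * (x (σ i) : ℂ) * Complex.I_mul_I
  · rw [charpoly_conj _ _ _ hUU, hc]

lemma reach {n : ℕ} (P : (Fin n → ℝ) → Prop)
    (hP : ∀ x, P x → ∀ j k : Fin n, j ≠ k → ∀ δ : ℝ, 0 ≤ δ → δ ≤ x k - x j →
      P (fun i => x i + (if i = j then δ else 0) - (if i = k then δ else 0)))
    (d : Fin n → ℝ) (hd : Monotone d) :
    ∀ (N : ℕ) (x : Fin n → ℝ), P x → (Finset.univ.filter (fun i => x i ≠ d i)).card ≤ N →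
      (∀ m : Fin n, ∑ i ∈ Finset.Iic m, x i ≤ ∑ i ∈ Finset.Iic m, d i) →
      ∑ i, x i = ∑ i, d i → P d := by
  intro N
  induction N with
  | zero =>
    intro x hx hc _ _
    have : x = d := by
      ext i
      by_contra h
      have : i ∈ Finset.univ.filter (fun i => x i ≠ d i) := by simpa using h
      have := Finset.card_pos.2 ⟨i, this⟩
      omega
    exact this ▸ hx
  | succ N ih =>
    intro x hx hc hsum htot
    by_cases hxd : x = d
    · exact hxd ▸ hx
    have hex : ∃ k, d k < x k := by
      by_contra! hcon
      apply hxd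
      ext i
      exact (Finset.sum_eq_sum_iff_of_le (fun i _ => hcon i)).1 htot i (Finset.mem_univ i)
    obtain ⟨k, hk, hmin⟩ : ∃ k, d k < x k ∧ ∀ i < k, x i ≤ d i := by
      have hne : (Finset.univ.filter (fun i => d i < x i)).Nonempty := by
        obtain ⟨k, hk⟩ := hex
        exact ⟨k, by simpa using hk⟩
      refine ⟨Finset.min' _ hne, ?_, ?_⟩
      · simpa using Finset.min'_mem _ hne
      · intro i hi
        by_contra! h
        exact absurd (Finset.min'_le _ i (by simpa using h)) (not_le.2 hi)
    obtain ⟨j, hjk, hj⟩ : ∃ j < k, x j < d j := by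
      by_contra! hcon
      have := hsum k
      have h2 : ∑ i ∈ Finset.Iic k, d i < ∑ i ∈ Finset.Iic k, x i := by
        apply Finset.sum_lt_sum
        · intro i hi
          rcases (Finset.mem_Iic.1 hi).lt_or_eq with h | h
          · exact hcon i h
          · rw [h]; exact hk.le
        · exact ⟨k, by simp, hk⟩
      linarith
    have hdjk := hd hjk.le
    let δ := min (d j - x j) (x k - d k)
    have hδ1 : δ ≤ d j - x j := min_le_left _ _
    have hδ2 : δ ≤ x k - d k := min_le_right _ _
    have hδ0 : 0 < δ := lt_min (by linarith) (by linarith)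
    refine ih _ (hP x hx j k hjk.ne δ hδ0.le (by linarith)) ?_ ?_ ?_
    · have : (Finset.univ.filter (fun i => x i + (if i = j then δ else 0)
          - (if i = k then δ else 0) ≠ d i)) ⊂ Finset.univ.filter (fun i => x i ≠ d i) := by
        rw [Finset.ssubset_iff_of_subset]
        · rcases min_choice (d j - x j) (x k - d k) with h | h
          · refine ⟨j, by simpa using hj.ne, ?_⟩
            have : δ = d j - x j := h
            simp [hjk.ne, this]
          · refine ⟨k, by simpa using hk.ne', ?_⟩
            have : δ = x k - d k := h
            simp [hjk.ne', this]
        · intro i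
          simp only [Finset.mem_filter, Finset.mem_univ, true_and]
          intro hi
          by_cases h1 : i = j
          · rw [h1]; exact hj.ne
          · by_cases h2 : i = k
            · rw [h2]; exact hk.ne'
            · simpa [h1, h2] using hi
      have := Finset.card_lt_card this
      omega
    · intro m
      rw [Finset.sum_sub_distrib, Finset.sum_add_distrib, Finset.sum_ite_eq', Finset.sum_ite_eq']
      simp only [Finset.mem_Iic]
      by_cases h1 : j ≤ m
      · by_cases h2 : k ≤ m
        · simp only [h1, h2, if_true]; linarith [hsum m]
        · simp only [h1, h2, if_true, if_false]
          have h3 : d j - x j ≤ ∑ i ∈ Finset.Iic m, (d i - x i) := by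
            apply Finset.single_le_sum (f := fun i => d i - x i)
            · intro i hi
              have := hmin i (lt_of_le_of_lt (Finset.mem_Iic.1 hi) (not_le.1 h2))
              linarith
            · simpa using h1
          rw [Finset.sum_sub_distrib] at h3
          linarith
      · have h2 : ¬ k ≤ m := fun h => h1 (hjk.le.trans h)
        simp only [h1, h2, if_false]; linarith [hsum m]
    · rw [Finset.sum_sub_distrib, Finset.sum_add_distrib, Finset.sum_ite_eq', Finset.sum_ite_eq']
      simp [htot]

lemma ach_of_hull {n : ℕ} (lam d : Fin n → ℝ)
    (h : d ∈ convexHull ℝ {x : Fin n → ℝ | ∃ σ : Equiv.Perm (Fin n), x = fun i => lam (σ i)}) :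
    Ach lam d := by
  let τ := Tuple.sort d
  let ρ := Tuple.sort lam
  have hτ : Monotone (d ∘ τ) := Tuple.monotone_sort d
  have hρ : Monotone (lam ∘ ρ) := Tuple.monotone_sort lam
  have hsub : convexHull ℝ {x : Fin n → ℝ | ∃ σ : Equiv.Perm (Fin n), x = fun i => lam (σ i)} ⊆
      {x : Fin n → ℝ | (∀ m : Fin n, ∑ i ∈ Finset.Iic m, lam (ρ i) ≤ ∑ i ∈ Finset.Iic m, x (τ i))
        ∧ ∑ i, lam i = ∑ i, x i} := by
    apply convexHull_min
    · rintro x ⟨σ, rfl⟩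
      refine ⟨fun m => ?_, (Equiv.sum_comp σ lam).symm⟩
      have hmv : Monovary (fun i : Fin n => if i ≤ m then (-1 : ℝ) else 0) (lam ∘ ρ) := by
        apply Monotone.monovary _ hρ
        intro a b hab
        by_cases hb : b ≤ m
        · simp [hb, hab.trans hb]
        · simp only [hb, if_false]; split_ifs <;> norm_num
      have key := hmv.sum_mul_comp_perm_le_sum_mul (σ := (τ.trans σ).trans ρ.symm)
      have e : ∀ g : Fin n → ℝ, ∑ i, (if i ≤ m then (-1 : ℝ) else 0) * g i
          = - ∑ i ∈ Finset.Iic m, g i := by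
        intro g
        have : Finset.Iic m = Finset.univ.filter (fun i => i ≤ m) := by ext; simp
        rw [this, Finset.sum_filter, ← Finset.sum_neg_distrib]
        apply Finset.sum_congr rfl
        intro i _
        split_ifs <;> simp
      rw [e, e] at key
      simp at key
      exact key
    · intro x hx y hy a b ha hb hab
      refine ⟨fun m => ?_, ?_⟩
      · simp only [Pi.add_apply, Pi.smul_apply, smul_eq_mul, Finset.sum_add_distrib,
          ← Finset.mul_sum]
        have h1 := mul_le_mul_of_nonneg_left (hx.1 m) ha
        have h2 := mul_le_mul_of_nonneg_left (hy.1 m) hb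
        have h3 : (a + b) * ∑ i ∈ Finset.Iic m, lam (ρ i) = ∑ i ∈ Finset.Iic m, lam (ρ i) := by
          rw [hab, one_mul]
        linarith
      · simp only [Pi.add_apply, Pi.smul_apply, smul_eq_mul, Finset.sum_add_distrib,
          ← Finset.mul_sum]
        rw [← hx.2, ← hy.2, ← add_mul, hab, one_mul]
  obtain ⟨hm, hs⟩ := hsub h
  have key : Ach lam (d ∘ τ) := by
    refine reach (Ach lam) ?_ (d ∘ τ) hτ _ (lam ∘ ρ) (ach_perm (ach_self lam) ρ) le_rfl hm ?_
    · intro x hx j k hjk δ h0 h1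
      obtain ⟨t, ht0, ht1, ht⟩ : ∃ t : ℝ, 0 ≤ t ∧ t ≤ 1 ∧ t * (x k - x j) = δ := by
        rcases (h0.trans h1).eq_or_lt with h | h
        · exact ⟨0, le_rfl, zero_le_one, by linarith⟩
        · exact ⟨δ / (x k - x j), by positivity, (div_le_one h).2 h1, by field_simp⟩
      convert ach_T hx j k hjk t ht0 ht1 using 1
      ext i
      by_cases h1 : i = j
      · subst h1; simp [hjk]; linarith
      · by_cases h2 : i = k
        · subst h2; simp [hjk.symm]; linarith
        · simp [h1, h2, Equiv.swap_apply_of_ne_of_ne h1 h2]; ring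
    · calc ∑ i, (lam ∘ ρ) i = ∑ i, lam i := Equiv.sum_comp ρ lam
        _ = ∑ i, d i := hs
        _ = _ := (Equiv.sum_comp τ d).symm
  have := ach_perm key τ.symm
  simpa [Function.comp_assoc] using this

lemma exists_perm {n : ℕ} (f g : Fin n → ℝ)
    (h : Finset.univ.val.map f = Finset.univ.val.map g) :
    ∃ τ : Equiv.Perm (Fin n), ∀ i, f i = g (τ i) := by
  have : ∀ c, Nonempty ({a // f a = c} ≃ {b // g b = c}) := by
    intro c
    rw [← Fintype.card_eq, Fintype.card_subtype, Fintype.card_subtype]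
    have := congrArg (Multiset.count c) h
    rw [Multiset.count_map, Multiset.count_map] at this
    simpa [Finset.card_def, eq_comm] using this
  refine ⟨Equiv.ofFiberEquiv (fun c => (this c).some), fun i => ?_⟩
  exact (Equiv.ofFiberEquiv_map _ i).symm

lemma hull_of_herm {n : ℕ} (lam d : Fin n → ℝ) (A : Matrix (Fin n) (Fin n) ℂ)
    (hA : A.IsHermitian) (hd : ∀ j, A j j = (d j : ℂ))
    (h : Finset.univ.val.map hA.eigenvalues = Finset.univ.val.map lam) :
    d ∈ convexHull ℝ {x : Fin n → ℝ | ∃ σ : Equiv.Perm (Fin n), x = fun i => lam (σ i)} := by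
  obtain ⟨τ, hτ⟩ := exists_perm _ _ h
  let U : Matrix (Fin n) (Fin n) ℂ := hA.eigenvectorUnitary
  have hU1 : U * Uᴴ = 1 := Matrix.mem_unitaryGroup_iff.1 hA.eigenvectorUnitary.2
  have hU2 : Uᴴ * U = 1 := Matrix.mem_unitaryGroup_iff'.1 hA.eigenvectorUnitary.2
  have hsp : A = U * Matrix.diagonal (fun i => (hA.eigenvalues i : ℂ)) * Uᴴ := by
    have := hA.spectral_theorem
    rw [Unitary.conjStarAlgAut_apply] at this
    exact this
  let M : Matrix (Fin n) (Fin n) ℝ := Matrix.of fun i j => Complex.normSq (U i j)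
  have hM : M ∈ doublyStochastic ℝ (Fin n) := by
    rw [mem_doublyStochastic_iff_sum]
    refine ⟨fun i j => Complex.normSq_nonneg _, fun i => ?_, fun j => ?_⟩
    · have := congrFun (congrFun hU1 i) i
      rw [Matrix.mul_apply, Matrix.one_apply_eq] at this
      have h2 : ((∑ j, M i j : ℝ) : ℂ) = 1 := by
        rw [← this]; push_cast
        refine Finset.sum_congr rfl fun j _ => ?_
        exact (Complex.mul_conj _).symm
      exact_mod_cast h2
    · have := congrFun (congrFun hU2 j) j
      rw [Matrix.mul_apply, Matrix.one_apply_eq] at this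
      have h2 : ((∑ i, M i j : ℝ) : ℂ) = 1 := by
        rw [← this]; push_cast
        refine Finset.sum_congr rfl fun i _ => ?_
        rw [mul_comm]
        exact (Complex.mul_conj _).symm
      exact_mod_cast h2
  have hdM : ∀ i, d i = ∑ j, M i j * lam (τ j) := by
    intro i
    have h2 : ((d i : ℝ) : ℂ) = ((∑ j, M i j * lam (τ j) : ℝ) : ℂ) := by
      rw [← hd i]
      conv_lhs => rw [hsp]
      rw [Matrix.mul_apply]
      push_cast
      refine Finset.sum_congr rfl fun j _ => ?_
      rw [Matrix.mul_diagonal, ← hτ j]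
      have : U i j * Uᴴ j i = (M i j : ℂ) := Complex.mul_conj _
      rw [← this]; ring
    exact_mod_cast h2
  obtain ⟨w, hw0, hw1, hwM⟩ := exists_eq_sum_perm_of_mem_doublyStochastic hM
  refine mem_convexHull_of_exists_fintype w
    (fun σ : Equiv.Perm (Fin n) => fun i => lam (τ (σ i))) hw0 hw1 ?_ ?_
  · intro σ
    exact ⟨σ.trans τ, rfl⟩
  · ext i
    rw [hdM i, ← hwM]
    simp only [Finset.sum_apply, Pi.smul_apply, smul_eq_mul, Matrix.sum_apply, Matrix.smul_apply,
      Finset.sum_mul]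
    rw [Finset.sum_comm]
    refine Finset.sum_congr rfl fun σ _ => ?_
    simp [Equiv.Perm.permMatrix, PEquiv.toMatrix_apply, Equiv.toPEquiv_apply]

end SchurHornAux

/-- **Schur–Horn theorem.** There exists an `n × n` complex Hermitian matrix with
diagonal entries `d` and multiset of eigenvalues `{λ₁, …, λₙ}` if and only if `d`
lies in the convex hull of the permutations of `λ`. -/
theorem schur_horn (n : ℕ) (hn : 1 ≤ n) (lam d : Fin n → ℝ) :
    (∃ A : Matrix (Fin n) (Fin n) ℂ, ∃ hA : A.IsHermitian,
      (∀ j, A j j = (d j : ℂ)) ∧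
      Finset.univ.val.map hA.eigenvalues = Finset.univ.val.map lam) ↔
    d ∈ convexHull ℝ {x : Fin n → ℝ | ∃ σ : Equiv.Perm (Fin n), x = fun i => lam (σ i)} := by
  constructor
  · rintro ⟨A, hA, hd, h⟩
    exact SchurHornAux.hull_of_herm lam d A hA hd h
  · intro h
    obtain ⟨A, hA, hd, hc⟩ := SchurHornAux.ach_of_hull lam d h
    refine ⟨A, hA, hd, ?_⟩
    have h1 := hA.roots_charpoly_eq_eigenvalues
    rw [hc, Polynomial.roots_prod _ _ (by
      simp [Finset.prod_ne_zero_iff, Polynomial.X_sub_C_ne_zero])] at h1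
    have h2 : Multiset.map (fun r : ℝ => (r : ℂ)) (Finset.univ.val.map hA.eigenvalues)
        = Multiset.map (fun r : ℝ => (r : ℂ)) (Finset.univ.val.map lam) := by
      rw [Multiset.map_map, Multiset.map_map]
      simp only [Polynomial.roots_X_sub_C, Multiset.bind_singleton] at h1
      exact h1.symm
    exact Multiset.map_injective Complex.ofReal_injective h2
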